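/- Let X = (X_1,...,X_m) and Y = (Y_1,...,Y_n) be arbitrary measurements (POVMs) on a finite-dimensional complex Hilbert space and let ρ be any density operator. Then H(X,ρ) + H(Y,ρ) ≥ -2 log₂ max_{i,j} ‖X_i^{1/2} Y_j^{1/2}‖, where ‖·‖ is the operator norm and H(X,ρ) = -Σ_i Tr(ρ X_i) log₂ Tr(ρ X_i). -/

import Mathlib

open Complex in
/-- If an exponential sum `∑ cₖ exp (aₖ z)` has value `1` at `0`, is bounded by `1` on the imaginary
axis and by `C` on the line `re z = 1`, then its derivative at `0` has real part at most `log C`. -/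
lemma re_sum_mul_le_log_of_exp_sum_bounds {ι : Type*} [Fintype ι] (c : ι → ℂ) (a : ι → ℝ) {C : ℝ}
    (hC : 0 < C) (hsum : ∑ k, c k = 1)
    (him : ∀ t : ℝ, ‖∑ k, c k * exp (I * (t * a k : ℝ))‖ ≤ 1)
    (hone : ∑ k, ‖c k‖ * Real.exp (a k) ≤ C) :
    (∑ k, c k * a k).re ≤ Real.log C := by
  set f : ℂ → ℂ := fun z => ∑ k, c k * exp (z * a k) with hf
  have hnorm (z : ℂ) : ‖f z‖ ≤ ∑ k, ‖c k‖ * Real.exp (z.re * a k) := by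
    refine (norm_sum_le _ _).trans (Finset.sum_le_sum fun k _ => ?_)
    rw [norm_mul, norm_exp]
    simp
  have hbdd : BddAbove ((norm ∘ f) '' HadamardThreeLines.verticalClosedStrip 0 1) := by
    refine ⟨∑ k, ‖c k‖ * Real.exp |a k|, ?_⟩
    rintro _ ⟨z, ⟨hz0, hz1⟩, rfl⟩
    refine (hnorm z).trans (Finset.sum_le_sum fun k _ => ?_)
    gcongr
    calc z.re * a k ≤ |z.re * a k| := le_abs_self _
      _ = z.re * |a k| := by rw [abs_mul, abs_of_nonneg hz0]
      _ ≤ |a k| := mul_le_of_le_one_left (abs_nonneg _) hz1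
  have hbound (t : ℝ) (ht : t ∈ Set.Ioo (0 : ℝ) 1) : (f t).re ≤ C ^ t := by
    have := HadamardThreeLines.norm_le_interp_of_mem_verticalClosedStrip₀₁' f (z := t)
      (a := 1) (b := C) ⟨by simpa using ht.1.le, by simpa using ht.2.le⟩
      (Differentiable.diffContOnCl (by fun_prop)) hbdd ?_ ?_
    · simpa using (re_le_norm _).trans this
    · intro z hz
      have hz' : z = I * z.im := by
        apply Complex.ext <;> simp_all
      have := him z.im
      rw [hz']
      simpa [hf, mul_assoc] using this
    · intro z hz
      refine (hnorm z).trans (le_trans (le_of_eq ?_) hone)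
      have : z.re = 1 := hz
      simp [this]
  have hderiv : HasDerivAt (fun t : ℝ => C ^ t - (f t).re)
      (Real.log C - (∑ k, c k * a k).re) 0 := by
    have h1 : HasDerivAt f (∑ k, c k * a k) ((0 : ℝ) : ℂ) := by
      refine HasDerivAt.fun_sum fun k _ => ?_
      have := (((hasDerivAt_id ((0 : ℝ) : ℂ)).mul_const (a k : ℂ)).cexp).const_mul (c k)
      simpa using this
    have h2 := h1.real_of_complex
    have h3 := Real.hasStrictDerivAt_const_rpow hC 0
    simpa using h3.hasDerivAt.fun_sub h2
  have htend := (hasDerivWithinAt_iff_tendsto_slope' (Set.self_notMem_Ioi (a := (0 : ℝ)))).1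
    hderiv.hasDerivWithinAt
  refine sub_nonneg.1 (ge_of_tendsto htend ?_)
  filter_upwards [Ioo_mem_nhdsGT (zero_lt_one (α := ℝ))] with t ht
  have := hbound t ht
  simp only [slope_def_field, hf] at this ⊢
  simp only [ofReal_zero, zero_mul, exp_zero, mul_one, hsum, Real.rpow_zero, one_re, sub_self,
    sub_zero]
  exact div_nonneg (by linarith) ht.1.le

section Measurement

variable {α β K : Type*} [Fintype α] [Fintype β] [NormedAddCommGroup K] [InnerProductSpace ℂ K]

open scoped InnerProductSpace

lemma norm_sum_smul_apply_le_one {S : α → K →ₗ[ℂ] K} (hS : ∀ i, (S i).IsSymmetric)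
    (hsum : ∀ v, ∑ i, S i (S i v) = v) (u : α → ℂ) (hu : ∀ i, ‖u i‖ = 1) {ψ : K} (hψ : ‖ψ‖ = 1) :
    ‖∑ i, u i • S i (S i ψ)‖ ≤ 1 := by
  have hsq (v : K) : ∑ i, ‖S i v‖ ^ 2 = ‖v‖ ^ 2 := by
    have h : ∑ i, ⟪S i v, S i v⟫_ℂ = ⟪v, v⟫_ℂ := by
      conv_rhs => rw [← hsum v, sum_inner]
      rw [hsum v]
      exact Finset.sum_congr rfl fun i _ => (hS i _ _).symm
    simp only [inner_self_eq_norm_sq_to_K] at h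
    exact_mod_cast h
  set w := ∑ i, u i • S i (S i ψ) with hw
  have h1 : ‖w‖ ^ 2 ≤ ∑ i, ‖S i w‖ * ‖S i ψ‖ := by
    have h : ⟪w, w⟫_ℂ = ∑ i, u i * ⟪S i w, S i ψ⟫_ℂ := by
      conv_lhs => rw [hw, inner_sum]
      rw [← hw]
      exact Finset.sum_congr rfl fun i _ => by rw [inner_smul_right, hS i]
    have h' := congrArg norm h
    rw [inner_self_eq_norm_sq_to_K] at h'
    have h2 : ‖w‖ ^ 2 = ‖∑ i, u i * ⟪S i w, S i ψ⟫_ℂ‖ := by simpa using h'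
    rw [h2]
    refine (norm_sum_le _ _).trans (Finset.sum_le_sum fun i _ => ?_)
    rw [norm_mul, hu, one_mul]
    exact norm_inner_le_norm _ _
  have h2 : ∑ i, ‖S i w‖ * ‖S i ψ‖ ≤ ∑ i, (‖S i w‖ ^ 2 + ‖S i ψ‖ ^ 2) / 2 :=
    Finset.sum_le_sum fun i _ => by nlinarith [sq_nonneg (‖S i w‖ - ‖S i ψ‖)]
  rw [← Finset.sum_div, Finset.sum_add_distrib, hsq, hsq, hψ] at h2
  nlinarith [norm_nonneg w]

/-- The Maassen–Uffink inequality for a pure state, in nats, for measurements with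
measurement operators `S i ^ 2` and `T j ^ 2`. -/
lemma sum_mul_log_add_le_two_mul_log {S : α → K →ₗ[ℂ] K} {T : β → K →ₗ[ℂ] K}
    (hS : ∀ i, (S i).IsSymmetric) (hSsum : ∀ v, ∑ i, S i (S i v) = v)
    (hT : ∀ j, (T j).IsSymmetric) (hTsum : ∀ v, ∑ j, T j (T j v) = v)
    {ψ : K} (hψ : ‖ψ‖ = 1) {C : ℝ} (hC : ∀ i j v, ‖S i (T j v)‖ ≤ C * ‖v‖) :
    ∑ i, ‖S i ψ‖ ^ 2 * Real.log (‖S i ψ‖ ^ 2) + ∑ j, ‖T j ψ‖ ^ 2 * Real.log (‖T j ψ‖ ^ 2) ≤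
      2 * Real.log C := by
  set c : α × β → ℂ := fun k => ⟪S k.1 (S k.1 ψ), T k.2 (T k.2 ψ)⟫_ℂ with hc
  set a : α × β → ℝ := fun k => Real.log ‖S k.1 ψ‖ + Real.log ‖T k.2 ψ‖ with ha
  have hcnorm (k : α × β) : ‖c k‖ ≤ ‖S k.1 ψ‖ * (C * ‖T k.2 ψ‖) := by
    simp only [hc]
    rw [hS]
    exact (norm_inner_le_norm _ _).trans (by gcongr; exact hC _ _ _)
  have hrow (i : α) : ∑ j, c (i, j) = (‖S i ψ‖ ^ 2 : ℝ) := by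
    simp only [hc]
    rw [← inner_sum, hTsum, hS, inner_self_eq_norm_sq_to_K]
    simp
  have hcol (j : β) : ∑ i, c (i, j) = (‖T j ψ‖ ^ 2 : ℝ) := by
    simp only [hc]
    rw [← sum_inner, hSsum, ← hT, inner_self_eq_norm_sq_to_K]
    simp
  have hsum : ∑ k, c k = 1 := by
    simp only [hc]
    rw [Fintype.sum_prod_type]
    simp only [← inner_sum, hTsum]
    rw [← sum_inner, hSsum, inner_self_eq_norm_sq_to_K, hψ]
    simp
  have hsumS : ∑ i, ‖S i ψ‖ ^ 2 = 1 := by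
    rw [Fintype.sum_prod_type] at hsum
    simp only [hrow] at hsum
    exact_mod_cast hsum
  have hsumT : ∑ j, ‖T j ψ‖ ^ 2 = 1 := by
    rw [Fintype.sum_prod_type_right] at hsum
    simp only [hcol] at hsum
    exact_mod_cast hsum
  have hCpos : 0 < C := by
    by_contra! hC0
    have hzero (k : α × β) : c k = 0 := by
      refine norm_le_zero_iff.1 ((hcnorm k).trans ?_)
      exact mul_nonpos_of_nonneg_of_nonpos (norm_nonneg _)
        (mul_nonpos_of_nonpos_of_nonneg hC0 (norm_nonneg _))
    simp [hzero] at hsum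
  have hterm (k : α × β) : ‖c k‖ * Real.exp (a k) ≤ C * (‖S k.1 ψ‖ ^ 2 * ‖T k.2 ψ‖ ^ 2) := by
    have h := hcnorm k
    rcases (norm_nonneg (S k.1 ψ)).eq_or_lt with hs | hs
    · rw [← hs] at h ⊢
      have : ‖c k‖ = 0 := le_antisymm (by simpa using h) (norm_nonneg _)
      simp [this]
    rcases (norm_nonneg (T k.2 ψ)).eq_or_lt with ht | ht
    · rw [← ht] at h ⊢
      have : ‖c k‖ = 0 := le_antisymm (by simpa using h) (norm_nonneg _)
      simp [this]
    simp only [ha]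
    rw [Real.exp_add, Real.exp_log hs, Real.exp_log ht]
    calc ‖c k‖ * (‖S k.1 ψ‖ * ‖T k.2 ψ‖)
        ≤ ‖S k.1 ψ‖ * (C * ‖T k.2 ψ‖) * (‖S k.1 ψ‖ * ‖T k.2 ψ‖) := by gcongr
      _ = _ := by ring
  have key := re_sum_mul_le_log_of_exp_sum_bounds c a hCpos hsum ?_ ?_
  · have hval : ∑ k, c k * a k = ((∑ i, ‖S i ψ‖ ^ 2 * Real.log ‖S i ψ‖ +
        ∑ j, ‖T j ψ‖ ^ 2 * Real.log ‖T j ψ‖ : ℝ) : ℂ) := by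
      simp only [ha, Complex.ofReal_add, mul_add, Finset.sum_add_distrib]
      rw [Fintype.sum_prod_type, Fintype.sum_prod_type_right]
      simp only [← Finset.sum_mul, hrow, hcol]
      push_cast
      rfl
    rw [hval, Complex.ofReal_re] at key
    simp only [Real.log_pow, Nat.cast_ofNat, mul_left_comm _ (2 : ℝ), ← Finset.mul_sum]
    linarith
  · intro t
    set u : α → ℂ := fun i => Complex.exp (((-(t * Real.log ‖S i ψ‖) : ℝ) : ℂ) * Complex.I)
    set v : β → ℂ := fun j => Complex.exp (((t * Real.log ‖T j ψ‖ : ℝ) : ℂ) * Complex.I)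
    have hu (i : α) : ‖u i‖ = 1 := Complex.norm_exp_ofReal_mul_I _
    have hv (j : β) : ‖v j‖ = 1 := Complex.norm_exp_ofReal_mul_I _
    have h : ∑ k, c k * Complex.exp (Complex.I * (t * a k : ℝ)) =
        ⟪∑ i, u i • S i (S i ψ), ∑ j, v j • T j (T j ψ)⟫_ℂ := by
      rw [sum_inner, Fintype.sum_prod_type]
      refine Finset.sum_congr rfl fun i _ => ?_
      rw [inner_sum]
      refine Finset.sum_congr rfl fun j _ => ?_
      rw [inner_smul_left, inner_smul_right, ← Complex.exp_conj, ← mul_assoc, ← Complex.exp_add,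
        mul_comm]
      congr 2
      simp only [ha, map_mul, Complex.conj_ofReal, Complex.conj_I]
      push_cast
      ring
    rw [h]
    exact (norm_inner_le_norm _ _).trans (mul_le_one₀ (norm_sum_smul_apply_le_one hS hSsum u hu hψ)
      (norm_nonneg _) (norm_sum_smul_apply_le_one hT hTsum v hv hψ))
  · refine (Finset.sum_le_sum fun k _ => hterm k).trans (le_of_eq ?_)
    rw [← Finset.mul_sum, Fintype.sum_prod_type]
    simp only [← Finset.mul_sum, hsumT, mul_one, hsumS]

/-- The ampliation of an operator, acting coordinatewise on a finite direct sum of copies of the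
space. -/
def LinearMap.ampliation (ι : Type*) (A : K →ₗ[ℂ] K) :
    PiLp 2 (fun _ : ι => K) →ₗ[ℂ] PiLp 2 (fun _ : ι => K) where
  toFun v := WithLp.toLp 2 fun k => A (v k)
  map_add' v w := by ext k; simp
  map_smul' r v := by ext k; simp

@[simp]
lemma LinearMap.ampliation_apply {ι : Type*} (A : K →ₗ[ℂ] K) (v : PiLp 2 (fun _ : ι => K)) (k : ι) :
    A.ampliation ι v k = A (v k) := rfl

lemma LinearMap.IsSymmetric.ampliation {ι : Type*} [Fintype ι] {A : K →ₗ[ℂ] K}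
    (hA : A.IsSymmetric) : (A.ampliation ι).IsSymmetric := fun v w => by
  simp [PiLp.inner_apply, hA _ _]

lemma LinearMap.sum_ampliation_ampliation {ι : Type*} {S : α → K →ₗ[ℂ] K}
    (hS : ∀ v, ∑ i, S i (S i v) = v) (v : PiLp 2 (fun _ : ι => K)) :
    ∑ i, (S i).ampliation ι ((S i).ampliation ι v) = v := by
  ext k
  simp [WithLp.ofLp_sum, hS]

lemma LinearMap.norm_ampliation_ampliation_le {ι : Type*} [Fintype ι] {A B : K →ₗ[ℂ] K} {C : ℝ}
    (hC : 0 ≤ C) (h : ∀ x, ‖A (B x)‖ ≤ C * ‖x‖) (v : PiLp 2 (fun _ : ι => K)) :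
    ‖A.ampliation ι (B.ampliation ι v)‖ ≤ C * ‖v‖ := by
  rw [← sq_le_sq₀ (norm_nonneg _) (by positivity), mul_pow, PiLp.norm_sq_eq_of_L2,
    PiLp.norm_sq_eq_of_L2, Finset.mul_sum]
  refine Finset.sum_le_sum fun k _ => ?_
  rw [← mul_pow]
  exact pow_le_pow_left₀ (norm_nonneg _) (h (v k)) 2

end Measurement

open scoped InnerProductSpace in
/-- A positive operator `ρ` has a purification: a vector `ψ` in a finite direct sum of copies of the
space with `Tr (ρ S²) = ‖(S ⊕ ⋯ ⊕ S) ψ‖²` for all symmetric `S`. -/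
lemma ContinuousLinearMap.IsPositive.exists_purification {H : Type*} [NormedAddCommGroup H]
    [InnerProductSpace ℂ H] [FiniteDimensional ℂ H] {ρ : H →L[ℂ] H} (hρ : ρ.IsPositive) :
    ∃ ψ : PiLp 2 (fun _ : Fin (Module.finrank ℂ H) => H), ∀ S : H →L[ℂ] H,
      (S : H →ₗ[ℂ] H).IsSymmetric →
      (LinearMap.trace ℂ H ((ρ ∘L (S ∘L S) : H →L[ℂ] H) : H →ₗ[ℂ] H)).re =
        ‖(S : H →ₗ[ℂ] H).ampliation _ ψ‖ ^ 2 := by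
  have hsym : (ρ : H →ₗ[ℂ] H).IsSymmetric := hρ.toLinearMap.isSymmetric
  set b := hsym.eigenvectorBasis rfl
  set l := hsym.eigenvalues rfl
  have hl (k) : 0 ≤ l k := hρ.toLinearMap.nonneg_eigenvalues rfl k
  refine ⟨WithLp.toLp 2 fun k => ((√(l k) : ℝ) : ℂ) • b k, fun S hS => ?_⟩
  rw [LinearMap.trace_eq_sum_inner _ b, PiLp.norm_sq_eq_of_L2, Complex.re_sum]
  refine Finset.sum_congr rfl fun k _ => ?_
  have h1 : ⟪b k, (ρ : H →ₗ[ℂ] H) (S (S (b k)))⟫_ℂ = (l k * ‖S (b k)‖ ^ 2 : ℝ) := by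
    have h2 : ⟪b k, S (S (b k))⟫_ℂ = ⟪S (b k), S (b k)⟫_ℂ := (hS _ _).symm
    rw [← hsym, hsym.apply_eigenvectorBasis, inner_smul_left, h2, inner_self_eq_norm_sq_to_K]
    simp [l]
  refine (congrArg Complex.re h1).trans ?_
  rw [Complex.ofReal_re]
  simp [norm_smul, mul_pow, Real.sq_sqrt (hl k)]

theorem entropic_uncertainty_povm_mixed
    {H : Type*} [NormedAddCommGroup H] [InnerProductSpace ℂ H] [FiniteDimensional ℂ H]
    {m n : ℕ} (X : Fin m → H →L[ℂ] H) (Y : Fin n → H →L[ℂ] H)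
    (hX : ∀ i, (X i).IsPositive) (hXsum : ∑ i, X i = 1)
    (hY : ∀ j, (Y j).IsPositive) (hYsum : ∑ j, Y j = 1)
    (SX : Fin m → H →L[ℂ] H) (hSX : ∀ i, (SX i).IsPositive ∧ SX i ∘L SX i = X i)
    (SY : Fin n → H →L[ℂ] H) (hSY : ∀ j, (SY j).IsPositive ∧ SY j ∘L SY j = Y j)
    (ρ : H →L[ℂ] H) (hρpos : ρ.IsPositive)
    (hρtr : LinearMap.trace ℂ H (ρ : H →ₗ[ℂ] H) = 1) :
    (-∑ i, (LinearMap.trace ℂ H ((ρ ∘L X i : H →L[ℂ] H) : H →ₗ[ℂ] H)).re *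
        Real.logb 2 (LinearMap.trace ℂ H ((ρ ∘L X i : H →L[ℂ] H) : H →ₗ[ℂ] H)).re) +
      (-∑ j, (LinearMap.trace ℂ H ((ρ ∘L Y j : H →L[ℂ] H) : H →ₗ[ℂ] H)).re *
        Real.logb 2 (LinearMap.trace ℂ H ((ρ ∘L Y j : H →L[ℂ] H) : H →ₗ[ℂ] H)).re) ≥
    -2 * Real.logb 2 (sSup {r : ℝ | ∃ i j, r = ‖SX i ∘L SY j‖}) := by
  obtain ⟨ψ, hψ⟩ := hρpos.exists_purification
  have hSXsym (i : Fin m) : (SX i : H →ₗ[ℂ] H).IsSymmetric := (hSX i).1.toLinearMap.isSymmetric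
  have hSYsym (j : Fin n) : (SY j : H →ₗ[ℂ] H).IsSymmetric := (hSY j).1.toLinearMap.isSymmetric
  have hp (i : Fin m) := hψ (SX i) (hSXsym i)
  have hq (j : Fin n) := hψ (SY j) (hSYsym j)
  simp only [(hSX _).2] at hp
  simp only [(hSY _).2] at hq
  have hψ1 : ‖ψ‖ = 1 := by
    have h := hψ 1 LinearMap.IsSymmetric.id
    have h1 : ρ ∘L ((1 : H →L[ℂ] H) ∘L 1) = ρ := by ext; simp
    have h2 : ((1 : H →L[ℂ] H) : H →ₗ[ℂ] H).ampliation _ ψ = ψ := by ext; simp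
    rw [h1, h2, hρtr, Complex.one_re] at h
    nlinarith [norm_nonneg ψ]
  have hSXsum (v : H) : ∑ i, (SX i : H →ₗ[ℂ] H) ((SX i : H →ₗ[ℂ] H) v) = v := by
    have h := congrArg (fun A : H →L[ℂ] H => A v) hXsum
    simpa [← (hSX _).2] using h
  have hSYsum (v : H) : ∑ j, (SY j : H →ₗ[ℂ] H) ((SY j : H →ₗ[ℂ] H) v) = v := by
    have h := congrArg (fun A : H →L[ℂ] H => A v) hYsum
    simpa [← (hSY _).2] using h
  set C := sSup {r : ℝ | ∃ i j, r = ‖SX i ∘L SY j‖}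
  have hbdd : BddAbove {r : ℝ | ∃ i j, r = ‖SX i ∘L SY j‖} := by
    refine ((Set.finite_range fun k : Fin m × Fin n => ‖SX k.1 ∘L SY k.2‖).subset ?_).bddAbove
    rintro _ ⟨i, j, rfl⟩
    exact ⟨(i, j), rfl⟩
  have hCle (i : Fin m) (j : Fin n) : ‖SX i ∘L SY j‖ ≤ C := le_csSup hbdd ⟨i, j, rfl⟩
  have hCnorm (i : Fin m) (j : Fin n) (x : H) :
      ‖(SX i : H →ₗ[ℂ] H) ((SY j : H →ₗ[ℂ] H) x)‖ ≤ C * ‖x‖ :=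
    ((SX i ∘L SY j).le_opNorm x).trans (mul_le_mul_of_nonneg_right (hCle i j) (norm_nonneg x))
  have key := sum_mul_log_add_le_two_mul_log
    (K := PiLp 2 fun _ : Fin (Module.finrank ℂ H) => H)
    (S := fun i => (SX i : H →ₗ[ℂ] H).ampliation _) (T := fun j => (SY j : H →ₗ[ℂ] H).ampliation _)
    (fun i => (hSXsym i).ampliation) (LinearMap.sum_ampliation_ampliation hSXsum)
    (fun j => (hSYsym j).ampliation) (LinearMap.sum_ampliation_ampliation hSYsum) hψ1 fun i j =>
      LinearMap.norm_ampliation_ampliation_le ((norm_nonneg _).trans (hCle i j)) (hCnorm i j)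
  simp only [hp, hq, Real.logb, ← mul_div_assoc, ← Finset.sum_div]
  rw [ge_iff_le, ← neg_div, ← neg_div, ← add_div]
  refine div_le_div_of_nonneg_right ?_ (Real.log_nonneg one_le_two)
  linarith
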